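/- Let l ≥ 1 and let x < 2^l be a natural number with binary digits x_j (j = 0 is the least significant bit). For each 0 ≤ j < l define the permutation π_j of Fin (2^l) as follows: if x_j = 1, π_j swaps the positions 2^{j+1}·t and 2^{j+1}·t + 2^j for every t with 2^{j+1}·t + 2^j < 2^l, fixing all other positions; if x_j = 0, π_j is the identity. Then the composition π_{l-1} ∘ π_{l-2} ∘ ⋯ ∘ π_0 maps position x to position 0. (This is the correctness of the SWAP network of the SELECTSWAP quantum lookup table: after the l layers of controlled-SWAP gates indexed by the swap qubits, the register originally at address x is routed to the first register.) -/

import Mathlib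

/-- On a multiple `2 ^ k * (x / 2 ^ k)` a controlled swap layer clears bit `k` of `x`. -/
theorem swap_layer_clears_bit (x k : ℕ) :
    (if x.testBit k then
      (if 2 ^ k * (x / 2 ^ k) % 2 ^ (k + 1) = 0 then 2 ^ k * (x / 2 ^ k) + 2 ^ k
        else if 2 ^ k * (x / 2 ^ k) % 2 ^ (k + 1) = 2 ^ k then 2 ^ k * (x / 2 ^ k) - 2 ^ k
        else 2 ^ k * (x / 2 ^ k))
      else 2 ^ k * (x / 2 ^ k)) = 2 ^ (k + 1) * (x / 2 ^ (k + 1)) := by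
  have hdiv : x / 2 ^ (k + 1) = x / 2 ^ k / 2 := by
    rw [pow_succ, Nat.div_div_eq_div_mul]
  have hmod : 2 ^ k * (x / 2 ^ k) % 2 ^ (k + 1) = 2 ^ k * (x / 2 ^ k % 2) := by
    rw [pow_succ, Nat.mul_mod_mul_left]
  have hsplit : 2 ^ k * (x / 2 ^ k) =
      2 ^ (k + 1) * (x / 2 ^ k / 2) + 2 ^ k * (x / 2 ^ k % 2) := by
    conv_lhs => rw [← Nat.div_add_mod (x / 2 ^ k) 2]
    ring
  have hpos : 2 ^ k ≠ 0 := by positivity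
  rw [hmod, hdiv, Nat.testBit_eq_decide_div_mod_eq]
  rcases Nat.mod_two_eq_zero_or_one (x / 2 ^ k) with h | h
  · simp only [h] at hsplit ⊢
    simpa using hsplit
  · simp only [h, mul_one] at hsplit ⊢
    simp only [decide_true, if_true, if_neg hpos]
    omega

/-- After the first `k` layers the register at address `x` sits at `2 ^ k * (x / 2 ^ k)`. -/
theorem swap_network_foldl_range {l x : ℕ} (hx : x < 2 ^ l) (π : ℕ → Equiv.Perm (Fin (2 ^ l)))
    (hπ : ∀ j < l, ∀ p : Fin (2 ^ l),
      ((π j p : Fin (2 ^ l)) : ℕ) =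
        if x.testBit j then
          (if (p : ℕ) % 2 ^ (j + 1) = 0 then (p : ℕ) + 2 ^ j
            else if (p : ℕ) % 2 ^ (j + 1) = 2 ^ j then (p : ℕ) - 2 ^ j
            else (p : ℕ))
        else (p : ℕ)) {k : ℕ} (hk : k ≤ l) :
    (((List.range k).foldl (fun p j => π j p) ⟨x, hx⟩ : Fin (2 ^ l)) : ℕ) =
      2 ^ k * (x / 2 ^ k) := by
  induction k with
  | zero => simp
  | succ k ih =>
    rw [List.range_succ, List.foldl_append, List.foldl_cons, List.foldl_nil, hπ k hk,
      ih (Nat.le_of_succ_le hk), swap_layer_clears_bit]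

/-- Correctness of the SWAP network of the SELECTSWAP quantum lookup table:
with the swap qubits holding the binary address `x < 2^l`, the `j`-th layer
`π j` swaps positions `2^(j+1)·t` and `2^(j+1)·t + 2^j` (fixing all other
positions) exactly when bit `j` of `x` is `1`.  After the `l` layers
(applied with `j = 0` first), the register originally at address `x` is
routed to position `0`. -/
theorem selectswap_swap_network_correct (l : ℕ) (hl : 1 ≤ l) (x : ℕ)
    (hx : x < 2 ^ l) (π : ℕ → Equiv.Perm (Fin (2 ^ l)))
    (hπ : ∀ j < l, ∀ p : Fin (2 ^ l),
      ((π j p : Fin (2 ^ l)) : ℕ) =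
        if x.testBit j then
          (if (p : ℕ) % 2 ^ (j + 1) = 0 then (p : ℕ) + 2 ^ j
            else if (p : ℕ) % 2 ^ (j + 1) = 2 ^ j then (p : ℕ) - 2 ^ j
            else (p : ℕ))
        else (p : ℕ)) :
    (((List.range l).foldl (fun p j => π j p) ⟨x, hx⟩ : Fin (2 ^ l)) : ℕ) = 0 := by
  rw [swap_network_foldl_range hx π hπ le_rfl, Nat.div_eq_of_lt hx, mul_zero]
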